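/- Let k ≥ 3 be an integer and let T be a fixed tree on k vertices. If t = t(n) and b = b(n) satisfy t ≥ b and b/max{(n/t)^{k−2}, 1} → ∞ as n → ∞, then there exists a (t,b)-strategy B of Builder such that the probability that the purchased graph B_t contains a subgraph isomorphic to T tends to 1 as n → ∞. -/

import Mathlib

open Filter

attribute [local instance] Classical.propDecidable

/-- The edges of the complete graph on `Fin n`: non-diagonal unordered pairs. -/
abbrev CEdge (n : ℕ) : Type := {e : Sym2 (Fin n) // ¬ e.IsDiag}

/-- The sample space: a uniformly random ordering of the edges of `K_n`,
encoded as a bijection from positions to edges. -/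
abbrev EdgeOrdering (n : ℕ) : Type := Fin (Fintype.card (CEdge n)) ≃ CEdge n

/-- The uniform probability of an event on a finite sample space. -/
noncomputable def uprob {α : Type} [Fintype α] (P : α → Prop) : ℝ :=
  ((Finset.univ.filter P).card : ℝ) / (Fintype.card α : ℝ)

/-- A (deterministic) strategy of Builder: given the current time `s`, the graph `B_{s-1}`
of previously purchased edges, and the observed edge `e_s`, decide whether to purchase it. -/
def Strategy (n : ℕ) : Type := ℕ → Finset (CEdge n) → CEdge n → Bool

/-- Builder's purchased graph `B_s` at time `s`, playing strategy `S` with budget `b`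
on the ordering `ω`.  An edge is purchased iff the strategy accepts it and the budget permits. -/
noncomputable def build (n b : ℕ) (S : Strategy n) (ω : EdgeOrdering n) : ℕ → Finset (CEdge n)
  | 0 => ∅
  | s + 1 =>
    let P := build n b S ω s
    if h : s < Fintype.card (CEdge n) then
      if S s P (ω ⟨s, h⟩) = true ∧ P.card < b then insert (ω ⟨s, h⟩) P else P
    else P

/-- The degree of the vertex `v` in the graph given by the edge set `P`. -/
noncomputable def edegree (n : ℕ) (P : Finset (CEdge n)) (v : Fin n) : ℕ :=
  (P.filter (fun e => v ∈ (e : Sym2 (Fin n)))).card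


/-- The edge set `P` contains a copy of the graph `T` (as a subgraph). -/
def containsCopy {k : ℕ} (T : SimpleGraph (Fin k)) (n : ℕ) (P : Finset (CEdge n)) : Prop :=
  ∃ f : Fin k → Fin n, Function.Injective f ∧
    ∀ u v : Fin k, T.Adj u v → ∃ e ∈ P, (e : Sym2 (Fin n)) = s(f u, f v)

theorem build_congr {n b : ℕ} (S : Strategy n) {ω ω' : EdgeOrdering n} {s : ℕ}
    (h : ∀ i : Fin (Fintype.card (CEdge n)), (i : ℕ) < s → ω i = ω' i) :
    build n b S ω s = build n b S ω' s := by
  induction s with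
  | zero => rfl
  | succ s ih =>
    have ih' := ih fun i hi => h i (by omega)
    simp only [build, ih']
    split_ifs with h1 <;> first | rfl | simp_all

theorem build_mono {n b : ℕ} (S : Strategy n) (ω : EdgeOrdering n) {s t : ℕ} (hst : s ≤ t) :
    build n b S ω s ⊆ build n b S ω t := by
  induction t, hst using Nat.le_induction with
  | base => exact subset_rfl
  | succ t _ ih =>
    refine ih.trans ?_
    simp only [build]
    split_ifs
    · exact Finset.subset_insert _ _
    · exact subset_rfl
    · exact subset_rfl

/-- Conditionally on the first `s` edges, the next edge is uniform among the remaining ones. -/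
theorem sum_next_edge {n b : ℕ} (S : Strategy n) (F : Finset (CEdge n) → CEdge n → ℝ)
    (s : Fin (Fintype.card (CEdge n))) :
    ((Finset.Ici s).card : ℝ) * ∑ ω : EdgeOrdering n, F (build n b S ω s) (ω s) =
      ∑ ω : EdgeOrdering n, ∑ r ∈ Finset.Ici s, F (build n b S ω s) (ω r) := by
  rw [Finset.sum_comm, ← nsmul_eq_mul, ← Finset.sum_const]
  refine Finset.sum_congr rfl fun r hr => ?_
  have hsr : s ≤ r := by simpa using hr
  let σ : EdgeOrdering n ≃ EdgeOrdering n :=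
    { toFun := fun ω => (Equiv.swap s r).trans ω
      invFun := fun ω => (Equiv.swap s r).trans ω
      left_inv := fun ω => by ext x; simp
      right_inv := fun ω => by ext x; simp }
  rw [← Equiv.sum_comp σ]
  refine Finset.sum_congr rfl fun ω _ => ?_
  have hb : build n b S (σ ω) s = build n b S ω s := by
    refine build_congr S fun i hi => ?_
    have h1 : i ≠ s := by rintro rfl; exact lt_irrefl _ hi
    have h2 : i ≠ r := by
      rintro rfl
      exact absurd hi (not_lt.2 hsr)
    change ω (Equiv.swap s r i) = ω i
    rw [Equiv.swap_apply_of_ne_of_ne h1 h2]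
  have he : (σ ω) s = ω r := by
    change ω (Equiv.swap s r s) = ω r
    rw [Equiv.swap_apply_left]
  rw [hb, he]

/-- Purchase an edge iff fewer than `M` edges are owned and the enlarged graph satisfies `Good`. -/
noncomputable def growthStrategy (n M : ℕ) (Good : Finset (CEdge n) → Prop) : Strategy n :=
  fun _ P e => decide (P.card < M ∧ e ∉ P ∧ Good (insert e P))

section Growth

variable {n b M : ℕ} {Good : Finset (CEdge n) → Prop}

theorem build_growthStrategy_succ (hM : M ≤ b) (ω : EdgeOrdering n)
    (s : Fin (Fintype.card (CEdge n))) :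
    build n b (growthStrategy n M Good) ω (s + 1) =
      if (build n b (growthStrategy n M Good) ω s).card < M ∧
          ω s ∉ build n b (growthStrategy n M Good) ω s ∧
          Good (insert (ω s) (build n b (growthStrategy n M Good) ω s))
      then insert (ω s) (build n b (growthStrategy n M Good) ω s)
      else build n b (growthStrategy n M Good) ω s := by
  conv_lhs => rw [build]
  simp only [s.isLt, dif_pos, Fin.eta]
  generalize build n b (growthStrategy n M Good) ω s = P
  refine if_congr ?_ rfl rfl
  simp only [growthStrategy, decide_eq_true_eq]
  constructor
  · exact fun h => h.1
  · exact fun h => ⟨h, h.1.trans_le hM⟩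

theorem good_build_growthStrategy (hM : M ≤ b) (h0 : Good ∅) (ω : EdgeOrdering n) (s : ℕ) :
    Good (build n b (growthStrategy n M Good) ω s) ∧
      (build n b (growthStrategy n M Good) ω s).card ≤ M := by
  induction s with
  | zero => exact ⟨h0, by simp [build]⟩
  | succ s ih =>
    by_cases hs : s < Fintype.card (CEdge n)
    · have := build_growthStrategy_succ (Good := Good) hM ω ⟨s, hs⟩
      simp only at this
      rw [this]
      split_ifs with h
      · refine ⟨h.2.2, ?_⟩
        rw [Finset.card_insert_of_notMem h.2.1]
        exact h.1
      · exact ih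
    · simp only [build, hs, dif_neg, not_false_eq_true]
      exact ih

theorem sum_potential_step {t : ℕ} (hM : M ≤ b) (h0 : Good ∅) (w : ℕ → ℝ) (hw : ∀ c, 0 ≤ w c)
    (hgrow : ∀ P, Good P → P.card < M → (Fintype.card (CEdge n) : ℝ) ≤
      w P.card * (((Finset.univ.filter fun e => e ∉ P ∧ Good (insert e P)).card : ℝ) - t))
    (s : Fin (Fintype.card (CEdge n))) (hst : (s : ℕ) ≤ t) :
    (∑ ω : EdgeOrdering n, ∑ c ∈ Finset.Ico
        (build n b (growthStrategy n M Good) ω (s + 1)).card M, w c) +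
      ∑ ω : EdgeOrdering n,
        (if (build n b (growthStrategy n M Good) ω s).card < M then (1 : ℝ) else 0) ≤
    ∑ ω : EdgeOrdering n, ∑ c ∈ Finset.Ico
        (build n b (growthStrategy n M Good) ω s).card M, w c := by
  set F : Finset (CEdge n) → CEdge n → ℝ := fun P e =>
    if P.card < M ∧ e ∉ P ∧ Good (insert e P) then w P.card else 0 with hF
  have hstep : ∀ ω : EdgeOrdering n, ∑ c ∈ Finset.Ico
        (build n b (growthStrategy n M Good) ω (s + 1)).card M, w c =
      (∑ c ∈ Finset.Ico (build n b (growthStrategy n M Good) ω s).card M, w c) -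
        F (build n b (growthStrategy n M Good) ω s) (ω s) := by
    intro ω
    rw [build_growthStrategy_succ hM]
    simp only [hF]
    split_ifs with h
    · rw [Finset.card_insert_of_notMem h.2.1, Finset.sum_eq_sum_Ico_succ_bot h.1]
      ring
    · ring
  have hpos : (0 : ℝ) < (Finset.Ici s).card := by
    exact_mod_cast Finset.card_pos.2 ⟨s, by simp⟩
  have hcardle : ((Finset.Ici s).card : ℝ) ≤ Fintype.card (CEdge n) := by
    exact_mod_cast (Finset.card_le_univ _).trans (by simp)
  have hkey : ∑ ω : EdgeOrdering n,
        (if (build n b (growthStrategy n M Good) ω s).card < M then (1 : ℝ) else 0) ≤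
      ∑ ω : EdgeOrdering n, F (build n b (growthStrategy n M Good) ω s) (ω s) := by
    refine le_of_mul_le_mul_left ?_ hpos
    rw [sum_next_edge, Finset.mul_sum]
    refine Finset.sum_le_sum fun ω _ => ?_
    obtain ⟨hg, -⟩ := good_build_growthStrategy (b := b) hM h0 ω s
    generalize build n b (growthStrategy n M Good) ω s = P at hg
    split_ifs with hP
    · rw [mul_one]
      refine hcardle.trans ((hgrow P hg hP).trans ?_)
      have hFr : ∀ r, F P (ω r) = if ω r ∉ P ∧ Good (insert (ω r) P) then w P.card else 0 := by
        intro r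
        simp [hF, hP]
      simp only [hFr]
      rw [← Finset.sum_filter, Finset.sum_const, nsmul_eq_mul, mul_comm]
      refine mul_le_mul_of_nonneg_right ?_ (hw _)
      have hcount : (Finset.univ.filter fun e => e ∉ P ∧ Good (insert e P)).card ≤
          ((Finset.Ici s).filter fun r => ω r ∉ P ∧ Good (insert (ω r) P)).card + s := by
        have hsub : (Finset.univ.filter fun e => e ∉ P ∧ Good (insert e P)) ⊆
            (((Finset.Ici s).filter fun r => ω r ∉ P ∧ Good (insert (ω r) P)) ∪
              Finset.Iio s).image ω := by
          intro e he
          simp only [Finset.mem_filter, Finset.mem_univ, true_and] at he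
          simp only [Finset.mem_image, Finset.mem_union, Finset.mem_filter, Finset.mem_Ici,
            Finset.mem_Iio]
          refine ⟨ω.symm e, ?_, by simp⟩
          rcases le_or_gt s (ω.symm e) with h | h
          · left; simpa [h] using he
          · exact Or.inr h
        refine (Finset.card_le_card hsub).trans (Finset.card_image_le.trans
          ((Finset.card_union_le _ _).trans ?_))
        simp
      have : ((Finset.univ.filter fun e => e ∉ P ∧ Good (insert e P)).card : ℝ) ≤
          ((Finset.Ici s).filter fun r => ω r ∉ P ∧ Good (insert (ω r) P)).card + (t : ℝ) := by
        exact_mod_cast hcount.trans (by omega)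
      linarith
    · rw [mul_zero]
      refine Finset.sum_nonneg fun r _ => ?_
      simp only [hF]
      split_ifs
      · exact hw _
      · exact le_rfl
  simp only [hstep, Finset.sum_sub_distrib]
  linarith

/-- If at every size `c < M` a good graph has so many good one-edge extensions that an unseen one
arrives within expected time `w c`, then the expected time to a good graph with `M` edges is at
most `∑ c < M, w c`. -/
theorem mul_uprob_growthStrategy_le {t : ℕ} (hM : M ≤ b) (ht : t ≤ Fintype.card (CEdge n))
    (h0 : Good ∅) (w : ℕ → ℝ) (hw : ∀ c, 0 ≤ w c)
    (hgrow : ∀ P, Good P → P.card < M → (Fintype.card (CEdge n) : ℝ) ≤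
      w P.card * (((Finset.univ.filter fun e => e ∉ P ∧ Good (insert e P)).card : ℝ) - t)) :
    (t : ℝ) * (1 - uprob fun ω : EdgeOrdering n =>
        Good (build n b (growthStrategy n M Good) ω t) ∧
          (build n b (growthStrategy n M Good) ω t).card = M) ≤
      ∑ c ∈ Finset.range M, w c := by
  set B : EdgeOrdering n → ℕ → Finset (CEdge n) := build n b (growthStrategy n M Good) with hB
  have hind : ∀ s ≤ t,
      (∑ ω : EdgeOrdering n, ∑ c ∈ Finset.Ico (B ω s).card M, w c) +
        s * ∑ ω : EdgeOrdering n, (if (B ω t).card < M then (1 : ℝ) else 0) ≤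
      Fintype.card (EdgeOrdering n) * ∑ c ∈ Finset.range M, w c := by
    intro s
    induction s with
    | zero =>
      intro _
      simp [hB, build]
    | succ s ih =>
      intro hs
      have h1 := ih (by omega)
      have h2 := sum_potential_step (b := b) hM h0 w hw hgrow ⟨s, by omega⟩ (by simp; omega)
      simp only [← hB] at h2
      have h3 : ∑ ω : EdgeOrdering n, (if (B ω t).card < M then (1 : ℝ) else 0) ≤
          ∑ ω : EdgeOrdering n, (if (B ω s).card < M then (1 : ℝ) else 0) := by
        refine Finset.sum_le_sum fun ω _ => ?_
        have hle : (B ω s).card ≤ (B ω t).card :=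
          Finset.card_le_card (build_mono _ ω (by omega))
        split_ifs <;> first | omega | norm_num
      push_cast
      linarith
  have hfin := hind t le_rfl
  have hnn : 0 ≤ ∑ ω : EdgeOrdering n, ∑ c ∈ Finset.Ico (B ω t).card M, w c :=
    Finset.sum_nonneg fun _ _ => Finset.sum_nonneg fun _ _ => hw _
  have : Nonempty (EdgeOrdering n) := ⟨(Fintype.equivFin (CEdge n)).symm⟩
  have hΩ : (0 : ℝ) < Fintype.card (EdgeOrdering n) := by exact_mod_cast Fintype.card_pos
  have hsplit : ∑ ω : EdgeOrdering n, (if (B ω t).card < M then (1 : ℝ) else 0) =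
      Fintype.card (EdgeOrdering n) *
        (1 - uprob fun ω : EdgeOrdering n => Good (B ω t) ∧ (B ω t).card = M) := by
    have hcompl : (Finset.univ.filter fun ω : EdgeOrdering n => (B ω t).card < M) =
        (Finset.univ.filter fun ω : EdgeOrdering n => Good (B ω t) ∧ (B ω t).card = M)ᶜ := by
      ext ω
      obtain ⟨hg, hc⟩ := good_build_growthStrategy (b := b) hM h0 ω t
      simp only [← hB] at hg hc
      simp only [Finset.mem_filter, Finset.mem_univ, true_and, Finset.mem_compl, hg]
      omega
    rw [Finset.sum_boole, hcompl, Finset.card_compl, Nat.cast_sub (Finset.card_le_univ _), uprob,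
      mul_one_sub, mul_div_cancel₀ _ hΩ.ne']
    congr!
  rw [hsplit] at hfin
  refine le_of_mul_le_mul_left ?_ hΩ
  linarith

end Growth

/-- `P` is the union of `m` vertex-disjoint partial copies of a rooted tree with parent function
`p`: the `i`-th copy consists of the vertices `φ i 0, …, φ i (ℓ i)`, and no copy has a vertex of
index exceeding `h + 1`. -/
structure IsPartialForest {n m : ℕ} (p : ℕ → ℕ) (h : ℕ) (P : Finset (CEdge n))
    (φ : Fin m → ℕ → Fin n) (ℓ : Fin m → ℕ) : Prop where
  inj : ∀ i j i' j', j ≤ ℓ i → j' ≤ ℓ i' → φ i j = φ i' j' → i = i' ∧ j = j'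
  edge : ∀ i j, j + 1 ≤ ℓ i → ∃ e ∈ P, (e : Sym2 (Fin n)) = s(φ i (p (j + 1)), φ i (j + 1))
  touched : ∀ e ∈ P, ∀ x ∈ (e : Sym2 (Fin n)), ∃ i j, j ≤ ℓ i ∧ φ i j = x
  top : ∀ i, ℓ i ≤ h + 1

/-- There are `a h` partial copies having a vertex of index `h`, and `y` of them have already been
extended by a vertex of index `h + 1`. -/
def GrowthState {n : ℕ} (p a : ℕ → ℕ) (h y : ℕ) (P : Finset (CEdge n)) : Prop :=
  ∃ (φ : Fin (a 0) → ℕ → Fin n) (ℓ : Fin (a 0) → ℕ), IsPartialForest p h P φ ℓ ∧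
    (Finset.univ.filter fun i => ℓ i = h + 1).card = y ∧
    (Finset.univ.filter fun i => h ≤ ℓ i).card = a h

/-- Graphs occurring in the growth of `a 0` copies, where `a (h + 1)` copies are extended to a
vertex of index `h + 1` before moving on to index `h + 2`. -/
def IsGrowthGraph {n : ℕ} (p a : ℕ → ℕ) (K : ℕ) (P : Finset (CEdge n)) : Prop :=
  ∃ h y, h ≤ K ∧ y < a (h + 1) ∧ P.card = (∑ j ∈ Finset.range h, a (j + 1)) + y ∧
    GrowthState p a h y P

theorem GrowthState.next {n : ℕ} {p a : ℕ → ℕ} {h : ℕ} {P : Finset (CEdge n)}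
    (H : GrowthState p a h (a (h + 1)) P) : GrowthState p a (h + 1) 0 P := by
  obtain ⟨φ, ℓ, hF, h1, -⟩ := H
  refine ⟨φ, ℓ, ⟨hF.inj, hF.edge, hF.touched, fun i => (hF.top i).trans (by omega)⟩, ?_, ?_⟩
  · rw [Finset.card_eq_zero, Finset.filter_eq_empty_iff]
    intro i _
    have := hF.top i
    omega
  · rw [← h1]
    congr 1
    ext i
    have := hF.top i
    simp only [Finset.mem_filter, Finset.mem_univ, true_and]
    omega

theorem growthState_empty {n : ℕ} (p a : ℕ → ℕ) (h : a 0 ≤ n) :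
    GrowthState (n := n) p a 0 0 ∅ := by
  refine ⟨fun i _ => Fin.castLE h i, fun _ => 0, ⟨?_, ?_, ?_, ?_⟩, ?_, ?_⟩
  · intro i j i' j' hj hj' hij
    exact ⟨Fin.castLE_injective h hij, by omega⟩
  · intro i j hj
    omega
  · simp
  · simp
  · simp
  · simp

theorem IsPartialForest.insert {n m : ℕ} {p : ℕ → ℕ} {h : ℕ} {P : Finset (CEdge n)}
    {φ : Fin m → ℕ → Fin n} {ℓ : Fin m → ℕ} (hp : ∀ j, p (j + 1) ≤ j)
    (hF : IsPartialForest p h P φ ℓ) {i₀ : Fin m} (hi₀ : ℓ i₀ = h) {v : Fin n}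
    (hv : ∀ i j, j ≤ ℓ i → φ i j ≠ v) {e : CEdge n}
    (he : (e : Sym2 (Fin n)) = s(φ i₀ (p (h + 1)), v)) :
    IsPartialForest p h (insert e P)
      (Function.update φ i₀ (Function.update (φ i₀) (h + 1) v))
      (Function.update ℓ i₀ (h + 1)) := by
  set φ' := Function.update φ i₀ (Function.update (φ i₀) (h + 1) v) with hφ'
  set ℓ' := Function.update ℓ i₀ (h + 1) with hℓ'
  have hnew : φ' i₀ (h + 1) = v := by simp [hφ']
  have hold : ∀ i j, j ≤ ℓ i → φ' i j = φ i j := by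
    intro i j hj
    by_cases hi : i = i₀
    · subst hi
      have : j ≠ h + 1 := by omega
      simp [hφ', this]
    · simp [hφ', hi]
  have hℓ0 : ℓ' i₀ = h + 1 := by simp [hℓ']
  have hℓ1 : ∀ i, i ≠ i₀ → ℓ' i = ℓ i := fun i hi => by simp [hℓ', hi]
  have hcase : ∀ i j, j ≤ ℓ' i → (j ≤ ℓ i ∨ (i = i₀ ∧ j = h + 1)) := by
    intro i j hj
    by_cases hi : i = i₀
    · subst hi
      omega
    · rw [hℓ1 i hi] at hj
      exact Or.inl hj
  have hle : ∀ i, ℓ i ≤ ℓ' i := by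
    intro i
    by_cases hi : i = i₀
    · subst hi
      omega
    · rw [hℓ1 i hi]
  refine ⟨?_, ?_, ?_, ?_⟩
  · intro i j i' j' hj hj' hij
    rcases hcase i j hj with h1 | ⟨rfl, rfl⟩ <;> rcases hcase i' j' hj' with h2 | ⟨rfl, rfl⟩
    · rw [hold _ _ h1, hold _ _ h2] at hij
      exact hF.inj _ _ _ _ h1 h2 hij
    · rw [hold _ _ h1, hnew] at hij
      exact absurd hij (hv _ _ h1)
    · rw [hold _ _ h2, hnew] at hij
      exact absurd hij.symm (hv _ _ h2)
    · exact ⟨rfl, rfl⟩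
  · intro i j hj
    rcases hcase i _ hj with h1 | ⟨rfl, h1⟩
    · obtain ⟨f, hf, hfe⟩ := hF.edge i j h1
      refine ⟨f, Finset.mem_insert_of_mem hf, ?_⟩
      have := hp j
      rw [hfe, hold _ _ h1, hold _ _ (by omega)]
    · obtain rfl : j = h := by omega
      have := hp j
      refine ⟨e, Finset.mem_insert_self _ _, ?_⟩
      rw [he, hnew, hold _ _ (by omega)]
  · intro f hf x hx
    rcases Finset.mem_insert.1 hf with rfl | hf
    · rw [he, Sym2.mem_iff] at hx
      have := hp h
      rcases hx with rfl | rfl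
      · exact ⟨i₀, p (h + 1), by omega, hold _ _ (by omega)⟩
      · exact ⟨i₀, h + 1, by omega, hnew⟩
    · obtain ⟨i, j, hj, rfl⟩ := hF.touched f hf x hx
      exact ⟨i, j, hj.trans (hle i), hold _ _ hj⟩
  · intro i
    by_cases hi : i = i₀
    · subst hi
      omega
    · rw [hℓ1 i hi]
      exact hF.top i

/-- A growth state has many one-edge extensions. -/
theorem GrowthState.card_extensions {n : ℕ} {p a : ℕ → ℕ} (hp : ∀ j, p (j + 1) ≤ j) {h y : ℕ}
    {P : Finset (CEdge n)} (H : GrowthState p a h y P) :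
    (a h - y) * (n - a 0 * (h + 2)) ≤
      (Finset.univ.filter fun e => e ∉ P ∧ GrowthState p a h (y + 1) (insert e P)).card := by
  obtain ⟨φ, ℓ, hF, h1, h2⟩ := H
  set I := Finset.univ.filter fun i => ℓ i = h with hI
  set X : Finset (Fin n) := (Finset.univ.filter fun q : Fin (a 0) × Fin (h + 2) =>
    (q.2 : ℕ) ≤ ℓ q.1).image fun q => φ q.1 q.2 with hX
  have hIcard : I.card = a h - y := by
    have hsub : (Finset.univ.filter fun i => ℓ i = h + 1) ⊆
        Finset.univ.filter fun i => h ≤ ℓ i := by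
      intro i
      simp only [Finset.mem_filter, Finset.mem_univ, true_and]
      omega
    rw [← h1, ← h2, ← Finset.card_sdiff_of_subset hsub]
    congr 1
    ext i
    have := hF.top i
    simp only [hI, Finset.mem_sdiff, Finset.mem_filter, Finset.mem_univ, true_and]
    omega
  have hXmem : ∀ i j, j ≤ ℓ i → φ i j ∈ X := by
    intro i j hj
    have := hF.top i
    exact Finset.mem_image.2 ⟨(i, ⟨j, by omega⟩), by simpa using hj, rfl⟩
  have hXcard : X.card ≤ a 0 * (h + 2) := by
    refine Finset.card_image_le.trans ((Finset.card_le_univ _).trans ?_)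
    simp
  have hXc : n - a 0 * (h + 2) ≤ Xᶜ.card := by
    rw [Finset.card_compl, Fintype.card_fin]
    omega
  have hph := hp h
  have hu : ∀ i ∈ I, φ i (p (h + 1)) ∈ X := by
    intro i hi
    have : ℓ i = h := by simpa [hI] using hi
    exact hXmem _ _ (by omega)
  rw [← hIcard]
  refine (Nat.mul_le_mul_left _ hXc).trans ?_
  rw [← Finset.card_product]
  have hne : ∀ q ∈ I ×ˢ Xᶜ, ¬ (s(φ q.1 (p (h + 1)), q.2) : Sym2 (Fin n)).IsDiag := by
    intro q hq
    rw [Finset.mem_product, Finset.mem_compl] at hq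
    rw [Sym2.mk_isDiag_iff]
    intro heq
    exact hq.2 (heq ▸ hu _ hq.1)
  refine le_trans (Finset.card_le_card_of_injOn
    (t := (Finset.univ.filter fun e => e ∉ P ∧ GrowthState p a h (y + 1) (insert e P)).image
      Subtype.val) (fun q => (s(φ q.1 (p (h + 1)), q.2) : Sym2 (Fin n))) ?_ ?_)
    Finset.card_image_le
  · intro q hq
    have hq' := hq
    rw [Finset.mem_coe, Finset.mem_product, Finset.mem_compl] at hq'
    have hi : ℓ q.1 = h := by simpa [hI] using hq'.1
    have hv : ∀ i j, j ≤ ℓ i → φ i j ≠ q.2 := fun i j hj heq => hq'.2 (heq ▸ hXmem i j hj)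
    refine Finset.mem_coe.2 (Finset.mem_image.2 ⟨⟨_, hne q hq⟩, ?_, rfl⟩)
    simp only [Finset.mem_filter, Finset.mem_univ, true_and]
    refine ⟨?_, _, _, hF.insert hp hi hv rfl, ?_, ?_⟩
    · intro hmem
      obtain ⟨i, j, hj, hij⟩ := hF.touched _ hmem q.2 (Sym2.mem_mk_right _ _)
      exact hv i j hj hij
    · rw [← h1, ← Finset.card_insert_of_notMem (a := q.1) (by simp [hi])]
      congr 1
      ext i
      by_cases hii : i = q.1 <;> simp [hii]
    · rw [← h2]
      congr 1
      ext i
      by_cases hii : i = q.1 <;> simp [hii, hi]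
  · intro q hq q' hq' heq
    rw [Finset.mem_coe, Finset.mem_product, Finset.mem_compl] at hq hq'
    have hi : ℓ q.1 = h := by simpa [hI] using hq.1
    have hi' : ℓ q'.1 = h := by simpa [hI] using hq'.1
    rcases Sym2.eq_iff.1 heq with ⟨e1, e2⟩ | ⟨e1, -⟩
    · exact Prod.ext (hF.inj _ _ _ _ (by omega) (by omega) e1).1 e2
    · exact absurd (e1 ▸ hu _ hq.1) hq'.2

theorem GrowthState.isGrowthGraph_insert {n : ℕ} {p a : ℕ → ℕ} {K h y : ℕ}
    (ha : ∀ j, 0 < a j) {P : Finset (CEdge n)} (hK : h < K) (hy : y < a (h + 1))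
    (hP : P.card = (∑ j ∈ Finset.range h, a (j + 1)) + y) {e : CEdge n} (he : e ∉ P)
    (H : GrowthState p a h (y + 1) (insert e P)) : IsGrowthGraph p a K (insert e P) := by
  rcases Nat.lt_or_ge (y + 1) (a (h + 1)) with hlt | hge
  · refine ⟨h, y + 1, hK.le, hlt, ?_, H⟩
    rw [Finset.card_insert_of_notMem he, hP]
    ring
  · have heq : y + 1 = a (h + 1) := by omega
    refine ⟨h + 1, 0, hK, ha _, ?_, ?_⟩
    · rw [Finset.card_insert_of_notMem he, hP, Finset.sum_range_succ, ← heq]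
      ring
    · rw [heq] at H
      exact H.next

theorem sum_growth_mono {a : ℕ → ℕ} {h h' : ℕ} (hh : h ≤ h') :
    ∑ j ∈ Finset.range h, a (j + 1) ≤ ∑ j ∈ Finset.range h', a (j + 1) :=
  Finset.sum_le_sum_of_subset (Finset.range_subset_range.2 hh)

theorem IsGrowthGraph.exists_copy {n : ℕ} {p a : ℕ → ℕ} {K : ℕ} (ha : ∀ j, 0 < a j)
    {P : Finset (CEdge n)} (H : IsGrowthGraph p a K P)
    (hP : P.card = ∑ j ∈ Finset.range K, a (j + 1)) :
    ∃ φ : ℕ → Fin n, (∀ i j, i ≤ K → j ≤ K → φ i = φ j → i = j) ∧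
      ∀ j < K, ∃ e ∈ P, (e : Sym2 (Fin n)) = s(φ (p (j + 1)), φ (j + 1)) := by
  obtain ⟨h, y, hK, hy, hc, φ, ℓ, hF, -, h2⟩ := H
  obtain rfl : h = K := by
    by_contra hne
    have := sum_growth_mono (a := a) (show h + 1 ≤ K by omega)
    rw [Finset.sum_range_succ] at this
    omega
  have hpos : 0 < (Finset.univ.filter fun i => h ≤ ℓ i).card := h2 ▸ ha h
  obtain ⟨i, hi⟩ := Finset.card_pos.1 hpos
  have hi : h ≤ ℓ i := by simpa using hi
  exact ⟨φ i, fun j j' hj hj' heq => (hF.inj i j i j' (by omega) (by omega) heq).2,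
    fun j hj => hF.edge i j (by omega)⟩

theorem card_cEdge (n : ℕ) : Fintype.card (CEdge n) = n.choose 2 := by
  have := Sym2.card_subtype_not_diag (α := Fin n)
  rw [Fintype.card_fin] at this
  rw [← this]

/-- Growing `D ^ K` copies, where each level is shorter than the previous one by a factor `D`,
takes time at most `4 * K * n / D` in expectation. -/
theorem exists_growthStrategy {n K D t b : ℕ} {p : ℕ → ℕ} (hp : ∀ j, p (j + 1) ≤ j)
    (hD : 2 ≤ D) (hn : 2 * (K + 1) * D ^ K ≤ n) (ht : 8 * t ≤ n) (hb : K * D ^ (K - 1) ≤ b) :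
    ∃ S : Strategy n, (t : ℝ) * (1 - uprob fun ω : EdgeOrdering n =>
        IsGrowthGraph p (fun j => D ^ (K - j)) K (build n b S ω t) ∧
          (build n b S ω t).card = ∑ j ∈ Finset.range K, D ^ (K - (j + 1))) ≤
      4 * K * n / D := by
  set a : ℕ → ℕ := fun j => D ^ (K - j) with ha_def
  have ha : ∀ j, 0 < a j := fun j => pow_pos (by omega) _
  have haD : ∀ h < K, a h = D * a (h + 1) := by
    intro h hh
    simp only [ha_def]
    rw [← pow_succ']
    congr 1
    omega
  set A : ℕ → ℕ := fun h => ∑ j ∈ Finset.range h, a (j + 1) with hA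
  have hAsucc : ∀ h, A (h + 1) = A h + a (h + 1) := fun h => Finset.sum_range_succ _ _
  have hAb : A K ≤ b := by
    refine le_trans ?_ hb
    have : A K ≤ (Finset.range K).card • D ^ (K - 1) := by
      refine Finset.sum_le_card_nsmul _ _ _ fun j _ => ?_
      exact Nat.pow_le_pow_right (by omega) (by omega)
    simpa using this
  have hstage : ∀ h < K, ∀ y < a (h + 1),
      Nat.findGreatest (fun h' => A h' ≤ A h + y) K = h := by
    intro h hh y hy
    rw [Nat.findGreatest_eq_iff]
    refine ⟨hh.le, fun _ => Nat.le_add_right _ _, fun h' h1 _ hle => ?_⟩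
    have h3 : A (h + 1) ≤ A h' := sum_growth_mono h1
    rw [hAsucc] at h3
    omega
  set w : ℕ → ℝ := fun c => 4 * n / a (Nat.findGreatest (fun h => A h ≤ c) K) with hw
  have hDK : 1 ≤ D ^ K := Nat.one_le_pow _ _ (by omega)
  have hn2 : 2 ≤ n := by nlinarith
  have hN : (Fintype.card (CEdge n) : ℝ) = n * (n - 1) / 2 := by
    rw [card_cEdge, Nat.cast_choose_two]
  have hsum : ∀ h ≤ K, ∑ c ∈ Finset.range (A h), w c = h * (4 * n / D) := by
    intro h
    induction h with
    | zero => simp [hA]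
    | succ h ih =>
      intro hh
      rw [hAsucc, Finset.sum_range_add, ih (by omega),
        Finset.sum_congr rfl (g := fun _ => (4 * n / a h : ℝ)), Finset.sum_const,
        Finset.card_range, nsmul_eq_mul, haD h hh]
      · have h1 : (a (h + 1) : ℝ) ≠ 0 := by exact_mod_cast (ha _).ne'
        have h2 : (D : ℝ) ≠ 0 := by exact_mod_cast (by omega : D ≠ 0)
        push_cast
        field_simp
      · intro y hy
        simp only [hw]
        rw [hstage h hh y (Finset.mem_range.1 hy)]
  have hn2' : (2 : ℝ) ≤ n := by exact_mod_cast hn2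
  have htR : 8 * (t : ℝ) ≤ n := by exact_mod_cast ht
  have htN : t ≤ Fintype.card (CEdge n) := by
    have : (t : ℝ) ≤ Fintype.card (CEdge n) := by
      rw [hN]
      nlinarith
    exact_mod_cast this
  have ha0 : a 0 = D ^ K := by simp [ha_def]
  refine ⟨growthStrategy n (A K) (IsGrowthGraph p a K), ?_⟩
  refine (mul_uprob_growthStrategy_le hAb htN ?_ w (fun c => by positivity) ?_).trans_eq ?_
  · refine ⟨0, 0, Nat.zero_le _, ha _, by simp, growthState_empty p a ?_⟩
    rw [ha0]
    nlinarith
  · rintro P ⟨h, y, hhK, hy, hPc, hG⟩ hPM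
    have hh : h < K := by
      refine lt_of_le_of_ne hhK ?_
      rintro rfl
      rw [hPc] at hPM
      exact absurd hPM (by simp [hA])
    have hwP : w P.card = 4 * n / a h := by
      simp only [hw]
      rw [show P.card = A h + y from hPc, hstage h hh y hy]
    have hcount := (hG.card_extensions hp).trans (Finset.card_le_card
      (t := Finset.univ.filter fun e => e ∉ P ∧ IsGrowthGraph p a K (insert e P)) (by
        intro e he
        simp only [Finset.mem_filter, Finset.mem_univ, true_and] at he ⊢
        exact ⟨he.1, he.2.isGrowthGraph_insert ha hh hy hPc he.1⟩))
    set E := (Finset.univ.filter fun e => e ∉ P ∧ IsGrowthGraph p a K (insert e P)).card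
    have h1 : a h ≤ 2 * (a h - y) := by
      have := haD h hh
      have : 2 * a (h + 1) ≤ a h := by nlinarith
      omega
    have h2 : n ≤ 2 * (n - a 0 * (h + 2)) := by
      have : a 0 * (h + 2) ≤ (K + 1) * D ^ K := by
        rw [ha0, mul_comm]
        exact Nat.mul_le_mul_right _ (by omega)
      have : 2 * ((K + 1) * D ^ K) ≤ n := by linarith
      omega
    have h3 : a h * n ≤ 4 * E := by
      calc a h * n ≤ (2 * (a h - y)) * (2 * (n - a 0 * (h + 2))) := Nat.mul_le_mul h1 h2
        _ = 4 * ((a h - y) * (n - a 0 * (h + 2))) := by ring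
        _ ≤ 4 * E := Nat.mul_le_mul_left _ hcount
    have h3' : (a h : ℝ) * n ≤ 4 * E := by exact_mod_cast h3
    have h4 : (1 : ℝ) ≤ a h := by exact_mod_cast ha h
    have h5 : (a h : ℝ) * n / 8 ≤ E - t := by nlinarith
    rw [hwP, hN]
    calc (n : ℝ) * (n - 1) / 2 ≤ 4 * n / a h * (a h * n / 8) := by
          field_simp
          nlinarith
      _ ≤ _ := mul_le_mul_of_nonneg_left h5 (by positivity)
  · rw [hsum K le_rfl]
    ring

/-- The vertices of a tree can be listed so that every vertex but the first is adjacent to exactly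
one earlier vertex, its parent. -/
theorem exists_parent_ordering {K : ℕ} {T : SimpleGraph (Fin (K + 1))} (hT : T.IsTree) :
    ∃ (r : Fin (K + 1) → ℕ) (p : ℕ → ℕ), Function.Injective r ∧ (∀ u, r u ≤ K) ∧
      (∀ j, p (j + 1) ≤ j) ∧ ∀ u v, T.Adj u v →
        ∃ j < K, (r u = p (j + 1) ∧ r v = j + 1) ∨ (r v = p (j + 1) ∧ r u = j + 1) := by
  have hgrow : ∀ m ≤ K, ∃ (v : ℕ → Fin (K + 1)) (p : ℕ → ℕ),
      (∀ i j, i ≤ m → j ≤ m → v i = v j → i = j) ∧ (∀ j, p (j + 1) ≤ j) ∧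
        ∀ j < m, T.Adj (v (p (j + 1))) (v (j + 1)) := by
    intro m
    induction m with
    | zero =>
      exact fun _ => ⟨fun _ => 0, fun _ => 0, fun i j _ _ _ => by omega, fun _ => Nat.zero_le _,
        fun j hj => by omega⟩
    | succ m ih =>
      intro hm
      obtain ⟨v, p, hinj, hp, hadj⟩ := ih (by omega)
      obtain ⟨x, hx⟩ : ∃ x, x ∉ (Finset.range (m + 1)).image v := by
        by_contra! hall
        have h1 : Finset.univ ⊆ (Finset.range (m + 1)).image v := fun x _ => hall x
        have h2 := (Finset.card_le_card h1).trans Finset.card_image_le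
        simp at h2
        omega
      obtain ⟨q⟩ := hT.1.preconnected (v 0) x
      obtain ⟨d, -, hd1, hd2⟩ := q.exists_boundary_dart
        (((Finset.range (m + 1)).image v : Finset _) : Set (Fin (K + 1)))
        (by simp only [Finset.coe_image, Set.mem_image, Finset.mem_coe, Finset.mem_range]
            exact ⟨0, by omega, rfl⟩) hx
      obtain ⟨c, hc, hcd⟩ := Finset.mem_image.1 (Finset.mem_coe.1 hd1)
      rw [Finset.mem_range] at hc
      have hnew : ∀ j ≤ m, v j ≠ d.snd := fun j hj heq =>
        hd2 (Finset.mem_coe.2 (Finset.mem_image.2 ⟨j, Finset.mem_range.2 (by omega), heq⟩))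
      refine ⟨Function.update v (m + 1) d.snd, Function.update p (m + 1) c, ?_, ?_, ?_⟩
      · intro i j hi hj hij
        by_cases h1 : i = m + 1 <;> by_cases h2 : j = m + 1
        · omega
        · subst h1
          simp only [Function.update_self, Function.update_of_ne h2] at hij
          exact absurd hij.symm (hnew j (by omega))
        · subst h2
          simp only [Function.update_self, Function.update_of_ne h1] at hij
          exact absurd hij (hnew i (by omega))
        · simp only [Function.update_of_ne h1, Function.update_of_ne h2] at hij
          exact hinj i j (by omega) (by omega) hij
      · intro j
        by_cases h1 : j = m
        · subst h1
          simp only [Function.update_self]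
          omega
        · rw [Function.update_of_ne (by omega)]
          exact hp j
      · intro j hj
        by_cases h1 : j = m
        · subst h1
          rw [Function.update_self, Function.update_self, Function.update_of_ne (by omega), hcd]
          exact d.adj
        · have := hp j
          rw [Function.update_of_ne (by omega : j + 1 ≠ m + 1),
            Function.update_of_ne (by omega : j + 1 ≠ m + 1), Function.update_of_ne (by omega)]
          exact hadj j (by omega)
  obtain ⟨v, p, hinj, hp, hadj⟩ := hgrow K le_rfl
  have hbij : Function.Bijective fun i : Fin (K + 1) => v i := by
    rw [Fintype.bijective_iff_injective_and_card]
    exact ⟨fun i j hij => Fin.ext (hinj i j (by omega) (by omega) hij), rfl⟩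
  set σ := Equiv.ofBijective _ hbij
  have hr : ∀ j ≤ K, ∀ u, v j = u → (σ.symm u : ℕ) = j := by
    rintro j hj u rfl
    have : σ ⟨j, by omega⟩ = v j := rfl
    rw [← this, Equiv.symm_apply_apply]
  refine ⟨fun u => σ.symm u, p, fun u u' h => σ.symm.injective (Fin.ext h), fun u =>
    Nat.lt_succ_iff.1 (σ.symm u).isLt, hp, ?_⟩
  have hedges : (Finset.range K).image (fun j => s(v (p (j + 1)), v (j + 1))) =
      T.edgeFinset := by
    refine Finset.eq_of_subset_of_card_le ?_ ?_
    · intro e he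
      obtain ⟨j, hj, rfl⟩ := Finset.mem_image.1 he
      rw [SimpleGraph.mem_edgeFinset, SimpleGraph.mem_edgeSet]
      exact hadj j (Finset.mem_range.1 hj)
    · have hcard := hT.card_edgeFinset
      rw [Fintype.card_fin] at hcard
      rw [Finset.card_image_of_injOn, Finset.card_range]
      · omega
      · intro i hi j hj hij
        rw [Finset.mem_coe, Finset.mem_range] at hi hj
        have := hp i
        have := hp j
        rcases Sym2.eq_iff.1 hij with ⟨-, h⟩ | ⟨h, h'⟩
        · have := hinj _ _ (by omega) (by omega) h
          omega
        · have := hinj _ _ (by omega) (by omega) h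
          have := hinj _ _ (by omega) (by omega) h'
          omega
  intro u w huw
  have hmem : s(u, w) ∈ T.edgeFinset := by
    rw [SimpleGraph.mem_edgeFinset, SimpleGraph.mem_edgeSet]
    exact huw
  rw [← hedges] at hmem
  obtain ⟨j, hj, hje⟩ := Finset.mem_image.1 hmem
  rw [Finset.mem_range] at hj
  have := hp j
  refine ⟨j, hj, ?_⟩
  rcases Sym2.eq_iff.1 hje with ⟨h1, h2⟩ | ⟨h1, h2⟩
  · exact Or.inl ⟨hr _ (by omega) _ h1, hr _ (by omega) _ h2⟩
  · exact Or.inr ⟨hr _ (by omega) _ h1, hr _ (by omega) _ h2⟩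

theorem uprob_mono {α : Type} [Fintype α] {P Q : α → Prop} (h : ∀ x, P x → Q x) :
    uprob P ≤ uprob Q := by
  refine div_le_div_of_nonneg_right (Nat.cast_le.2 (Finset.card_le_card fun x hx => ?_))
    (Nat.cast_nonneg _)
  simp only [Finset.mem_filter, Finset.mem_univ, true_and] at hx ⊢
  exact h x hx

theorem uprob_le_one {α : Type} [Fintype α] (P : α → Prop) : uprob P ≤ 1 :=
  div_le_one_of_le₀ (by exact_mod_cast Finset.card_le_univ _) (Nat.cast_nonneg _)

/-- Among all strategies, one maximizes the probability of a given event. -/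
theorem exists_optimal_strategy (n : ℕ) (Q : Strategy n → EdgeOrdering n → Prop) :
    ∃ S, ∀ S', uprob (Q S') ≤ uprob (Q S) := by
  have : Nonempty (Strategy n) := ⟨fun _ _ _ => true⟩
  set f : Strategy n → ℕ := fun S => (Finset.univ.filter (Q S)).card with hf
  have hfle : ∀ S, f S ≤ Fintype.card (EdgeOrdering n) := fun S => Finset.card_le_univ _
  set g : Strategy n → ℕ := fun S => Fintype.card (EdgeOrdering n) - f S with hg
  refine ⟨Function.argmin g, fun S' => ?_⟩
  have h1 : g (Function.argmin g) ≤ g S' := Function.argmin_le g S'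
  have h2 : f S' ≤ f (Function.argmin g) := by
    have := hfle S'
    have := hfle (Function.argmin g)
    simp only [hg] at h1 this ⊢
    omega
  unfold uprob
  gcongr

/-- For every constant `L`, after shortening the time to at most `n / 8`, the budget still exceeds
the threshold by a factor `L`. -/
theorem eventually_threshold {K : ℕ} {t b : ℕ → ℕ} (htb : ∀ n, b n ≤ t n)
    (hb : Tendsto (fun n : ℕ => (b n : ℝ) / max (((n : ℝ) / (t n : ℝ)) ^ K) 1) atTop atTop)
    {L : ℝ} (hL : 0 < L) :
    ∀ᶠ n : ℕ in atTop, 0 < min (t n) (n / 8) ∧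
      L * ((n : ℝ) / (min (t n) (n / 8) : ℕ)) ^ K ≤ b n ∧
      L * ((n : ℝ) / (min (t n) (n / 8) : ℕ)) ^ K ≤ (min (t n) (n / 8) : ℕ) := by
  have hL' : 0 < L * 16 ^ K := by positivity
  filter_upwards [hb.eventually_ge_atTop (L * 16 ^ K), eventually_ge_atTop 16,
    tendsto_natCast_atTop_atTop.eventually_ge_atTop (16 * (L * 16 ^ K))] with n h1 h2 h3
  have hmax : 0 < max (((n : ℝ) / (t n : ℝ)) ^ K) 1 := lt_max_of_lt_right one_pos
  rw [le_div_iff₀ hmax] at h1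
  have h4 : L * 16 ^ K ≤ b n :=
    le_trans (le_mul_of_one_le_right hL'.le (le_max_right _ _)) h1
  have h5 : L * 16 ^ K * ((n : ℝ) / t n) ^ K ≤ b n :=
    le_trans (mul_le_mul_of_nonneg_left (le_max_left _ _) hL'.le) h1
  have htbR : (b n : ℝ) ≤ t n := by exact_mod_cast htb n
  have htpos : 0 < t n := by
    have : (0 : ℝ) < t n := by linarith
    exact_mod_cast this
  refine ⟨lt_min htpos (by omega), ?_⟩
  rcases le_total (t n) (n / 8) with hle | hle
  · rw [min_eq_left hle]
    have h6 : L * ((n : ℝ) / t n) ^ K ≤ b n := by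
      refine le_trans (mul_le_mul_of_nonneg_right ?_ (by positivity)) h5
      exact le_mul_of_one_le_right hL.le (one_le_pow₀ (by norm_num))
    exact ⟨h6, h6.trans htbR⟩
  · rw [min_eq_right hle]
    have h6 : (n : ℝ) ≤ 16 * (n / 8 : ℕ) := by
      exact_mod_cast (by omega : n ≤ 16 * (n / 8))
    have h7 : (0 : ℝ) < (n / 8 : ℕ) := by
      exact_mod_cast (by omega : 0 < n / 8)
    have h8 : L * ((n : ℝ) / (n / 8 : ℕ)) ^ K ≤ L * 16 ^ K := by
      gcongr
      rwa [div_le_iff₀ h7]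
    exact ⟨h8.trans h4, h8.trans (by linarith)⟩

/-- Small trees, 1-statement: if `t ≥ b` and `b ≫ max {(n/t)^{k-2}, 1}`, Builder has a
`(t,b)`-strategy whose purchased graph contains a copy of the `k`-vertex tree `T`
with high probability. -/
theorem stmt5 (k : ℕ) (hk : 3 ≤ k) (T : SimpleGraph (Fin k)) (hT : T.IsTree) (t b : ℕ → ℕ)
    (htb : ∀ n : ℕ, b n ≤ t n)
    (hb : Tendsto
      (fun n : ℕ => (b n : ℝ) / max (((n : ℝ) / (t n : ℝ)) ^ (k - 2)) 1) atTop atTop) :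
    ∃ S : (n : ℕ) → Strategy n,
      Tendsto
        (fun n => uprob (fun ω : EdgeOrdering n =>
          containsCopy T n (build n (b n) (S n) ω (t n))))
        atTop (nhds 1) := by
  obtain ⟨K, rfl⟩ : ∃ K, k = K + 1 + 1 := ⟨k - 2, by omega⟩
  simp only [show K + 1 + 1 - 2 = K by omega] at hb
  obtain ⟨r, p, hr, hrK, hp, hadj⟩ := exists_parent_ordering hT
  choose S hS using fun n => exists_optimal_strategy n fun S ω =>
    containsCopy T n (build n (b n) S ω (t n))
  refine ⟨S, tendsto_order.2 ⟨fun c hc => ?_, fun c hc =>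
    Eventually.of_forall fun n => (uprob_le_one _).trans_lt hc⟩⟩
  obtain ⟨C, hC1, hC⟩ : ∃ C : ℝ, 1 ≤ C ∧ 4 * (K + 1) / C < 1 - c := by
    refine ⟨max 1 (4 * (K + 1) / (1 - c) + 1), le_max_left _ _, ?_⟩
    have hc' : 0 < 1 - c := by linarith
    rw [div_lt_iff₀ (lt_max_of_lt_left one_pos), ← div_lt_iff₀' hc']
    exact lt_max_of_lt_right (lt_add_one _)
  set L : ℝ := 2 * (K + 2) * (2 * C) ^ (K + 1) with hL
  have hLpos : 0 < L := by positivity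
  filter_upwards [eventually_threshold htb hb hLpos] with n ⟨ht0, hLb, hLt⟩
  set t' := min (t n) (n / 8) with ht'
  have ht8 : 8 * t' ≤ n := by omega
  have ht0R : (0 : ℝ) < t' := by exact_mod_cast ht0
  set x : ℝ := n / t' with hx
  have hxn : x * t' = n := div_mul_cancel₀ _ ht0R.ne'
  have hx8 : 8 ≤ x := by
    rw [hx, le_div_iff₀ ht0R]
    exact_mod_cast ht8
  set D := ⌈C * x⌉₊ with hD
  have hCx : 8 ≤ C * x := by nlinarith
  have hD1 : C * x ≤ D := Nat.le_ceil _
  have hD2 : (D : ℝ) ≤ 2 * C * x := by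
    have := Nat.ceil_lt_add_one (show 0 ≤ C * x by linarith)
    linarith
  have hD3 : 2 ≤ D := by
    have : (2 : ℝ) ≤ D := by linarith
    exact_mod_cast this
  have hpowK : (D : ℝ) ^ K ≤ (2 * C) ^ K * x ^ K := by
    rw [← mul_pow]
    gcongr
  have hbud : (K + 1) * D ^ (K + 1 - 1) ≤ b n := by
    have : ((K : ℝ) + 1) * D ^ K ≤ b n := by
      refine le_trans ?_ hLb
      calc ((K : ℝ) + 1) * D ^ K ≤ (K + 1) * ((2 * C) ^ K * x ^ K) := by gcongr
        _ = ((K + 1) * (2 * C) ^ K) * x ^ K := by ring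
        _ ≤ L * x ^ K := by
          refine mul_le_mul_of_nonneg_right ?_ (by positivity)
          rw [hL]
          refine mul_le_mul (by linarith [(Nat.cast_nonneg K : (0 : ℝ) ≤ K)])
            (pow_le_pow_right₀ (by linarith) (Nat.le_succ K)) (by positivity) (by positivity)
    rw [Nat.add_sub_cancel]
    exact_mod_cast this
  have hvert : 2 * (K + 1 + 1) * D ^ (K + 1) ≤ n := by
    have : 2 * ((K : ℝ) + 1 + 1) * D ^ (K + 1) ≤ n := by
      calc 2 * ((K : ℝ) + 1 + 1) * D ^ (K + 1)
          ≤ 2 * ((K : ℝ) + 1 + 1) * (2 * C * x) ^ (K + 1) := by gcongr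
        _ = (L * x ^ K) * x := by rw [hL]; ring
        _ ≤ t' * x := mul_le_mul_of_nonneg_right hLt (by linarith)
        _ = n := by rw [mul_comm, hxn]
    exact_mod_cast this
  obtain ⟨S', hS'⟩ := exists_growthStrategy (b := b n) hp hD3 hvert ht8 hbud
  have hmono := uprob_mono (α := EdgeOrdering n)
    (P := fun ω => IsGrowthGraph p (fun j => D ^ (K + 1 - j)) (K + 1) (build n (b n) S' ω t') ∧
      (build n (b n) S' ω t').card = ∑ j ∈ Finset.range (K + 1), D ^ (K + 1 - (j + 1)))
    (Q := fun ω => containsCopy T n (build n (b n) S' ω (t n))) (by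
      rintro ω ⟨h1, h2⟩
      obtain ⟨φ, hφ, hφe⟩ := h1.exists_copy (fun j => pow_pos (by omega) _) h2
      refine ⟨fun u => φ (r u), fun u u' h => hr (hφ _ _ (hrK u) (hrK u') h), ?_⟩
      intro u v huv
      have hsub : build n (b n) S' ω t' ⊆ build n (b n) S' ω (t n) :=
        build_mono S' ω (min_le_left _ _)
      obtain ⟨j, hj, ⟨e1, e2⟩ | ⟨e1, e2⟩⟩ := hadj u v huv
      · obtain ⟨e, he, hee⟩ := hφe j hj
        exact ⟨e, hsub he, by simp only [hee, e1, e2]⟩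
      · obtain ⟨e, he, hee⟩ := hφe j hj
        exact ⟨e, hsub he, by simp only [hee, e1, e2, Sym2.eq_swap]⟩)
  refine lt_of_lt_of_le ?_ (hmono.trans (hS n S'))
  have hDpos : (0 : ℝ) < D := by linarith
  have hbound : 4 * ((K + 1 : ℕ) : ℝ) * n / D ≤ t' * (4 * (K + 1) / C) := by
    have hCpos : 0 < C := by linarith
    rw [← hxn, mul_div_assoc', div_le_div_iff₀ hDpos hCpos]
    push_cast
    have : 0 ≤ 4 * ((K : ℝ) + 1) * t' := by positivity
    nlinarith [mul_le_mul_of_nonneg_left hD1 this]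
  have := le_of_mul_le_mul_left (hS'.trans hbound) ht0R
  linarith
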